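/- arXiv:1709.07083 — 2 statements merged into one kernel-verified Lean document; each statement's English description precedes it below -/
import Mathlib

section
/- Let K and L be two Euclidean balls in ℝ^d contained in the interior of rB^d (d ≥ 2, r > 0). If for every point z ∈ rS^{d-1} the spherical projections K_z and L_z are congruent, then K = L. -/
open Metric Set

/-- The spherical projection of a set `M` from a point `z` on the sphere of radius `r`:
all points `x` of the sphere such that the segment `xz` meets `M`. -/
def sphProj {d : ℕ} (r : ℝ) (M : Set (EuclideanSpace ℝ (Fin d)))
    (z : EuclideanSpace ℝ (Fin d)) : Set (EuclideanSpace ℝ (Fin d)) :=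
  {x | ‖x‖ = r ∧ (segment ℝ x z ∩ M).Nonempty}

open scoped RealInnerProductSpace

lemma gram3_nonneg {E : Type*} [NormedAddCommGroup E] [InnerProductSpace ℝ E] (z p q : E) :
    0 ≤ ⟪z, z⟫ * (⟪p, p⟫ * ⟪q, q⟫ - ⟪p, q⟫ ^ 2) - ⟪z, p⟫ ^ 2 * ⟪q, q⟫
      - ⟪z, q⟫ ^ 2 * ⟪p, p⟫ + 2 * ⟪z, p⟫ * ⟪p, q⟫ * ⟪z, q⟫ := by
  have h := (Matrix.posSemidef_gram ℝ ![z, p, q]).det_nonneg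
  rw [Matrix.det_fin_three] at h
  simp only [Matrix.gram_apply, Matrix.cons_val] at h
  rw [real_inner_comm z p, real_inner_comm z q, real_inner_comm p q] at h
  linarith

lemma exists_perp {d : ℕ} (hd : 2 ≤ d) (r : ℝ) (hr : 0 < r) (y a : EuclideanSpace ℝ (Fin d)) :
    ∃ w : EuclideanSpace ℝ (Fin d), ‖w‖ = r ∧ ⟪w, y⟫ = 0 ∧ 0 ≤ ⟪w, a⟫ := by
  have h0 : ∃ w : EuclideanSpace ℝ (Fin d), w ≠ 0 ∧ ⟪w, y⟫ = 0 := by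
    have h1 := Submodule.finrank_add_finrank_orthogonal (ℝ ∙ y)
    have h2 : Module.finrank ℝ (ℝ ∙ y) ≤ 1 := by
      simpa using finrank_span_le_card (R := ℝ) ({y} : Set (EuclideanSpace ℝ (Fin d)))
    rw [finrank_euclideanSpace_fin] at h1
    have h3 : 0 < Module.finrank ℝ (ℝ ∙ y)ᗮ := by omega
    have h4 : (ℝ ∙ y)ᗮ ≠ ⊥ := by
      intro h
      rw [h] at h3
      simp at h3
    obtain ⟨w, hw, hw0⟩ := Submodule.exists_mem_ne_zero_of_ne_bot h4
    exact ⟨w, hw0, Submodule.mem_orthogonal_singleton_iff_inner_left.1 hw⟩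
  obtain ⟨w, hw0, hwy⟩ := h0
  have hn : 0 < ‖w‖ := norm_pos_iff.2 hw0
  rcases le_total 0 ⟪w, a⟫ with h | h
  · refine ⟨(r / ‖w‖) • w, ?_, ?_, ?_⟩
    · rw [norm_smul, Real.norm_of_nonneg (by positivity)]; field_simp
    · rw [inner_smul_left, hwy]; simp
    · rw [inner_smul_left]; simp; positivity
  · refine ⟨(-(r / ‖w‖)) • w, ?_, ?_, ?_⟩
    · rw [norm_smul, norm_neg, Real.norm_of_nonneg (by positivity)]; field_simp
    · rw [inner_smul_left, hwy]; simp
    · rw [inner_smul_left]; simp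
      exact mul_nonpos_of_nonneg_of_nonpos (by positivity) h

/-- A point of the sphere at prescribed angle from `y`. -/
lemma exists_at {d : ℕ} (hd : 2 ≤ d) (r : ℝ) (hr : 0 < r) (y a : EuclideanSpace ℝ (Fin d))
    (hy : ‖y‖ = r) (k : ℝ) (hk : -1 ≤ k) (hk1 : k ≤ 1) :
    ∃ x : EuclideanSpace ℝ (Fin d), ‖x‖ = r ∧ ⟪x, y⟫ = k * r ^ 2 ∧ k * ⟪y, a⟫ ≤ ⟪x, a⟫ := by
  obtain ⟨w, hw, hwy, hwa⟩ := exists_perp hd r hr y a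
  have hs : Real.sqrt (1 - k ^ 2) ^ 2 = 1 - k ^ 2 := Real.sq_sqrt (by nlinarith)
  have hs0 := Real.sqrt_nonneg (1 - k ^ 2)
  refine ⟨k • y + Real.sqrt (1 - k ^ 2) • w, ?_, ?_, ?_⟩
  · rw [← sq_eq_sq₀ (norm_nonneg _) hr.le, norm_add_sq_real, norm_smul, norm_smul,
      inner_smul_left, inner_smul_right, real_inner_comm, hwy, hy, hw, mul_pow, mul_pow,
      Real.norm_eq_abs, Real.norm_eq_abs, sq_abs, sq_abs, hs]
    simp
    ring
  · rw [inner_add_left, inner_smul_left, inner_smul_left, hwy, real_inner_self_eq_norm_sq, hy]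
    simp
  · rw [inner_add_left, inner_smul_left, inner_smul_left]
    simp
    positivity

lemma cap_mono {d : ℕ} (hd : 2 ≤ d) (r : ℝ) (hr : 0 < r) (y c : EuclideanSpace ℝ (Fin d))
    (hy : ‖y‖ = r) (hc : ‖c‖ = r) (k l : ℝ) (hk : -1 ≤ k) (hl1 : l ≤ 1)
    (h : ∀ x : EuclideanSpace ℝ (Fin d), ‖x‖ = r → k * r ^ 2 ≤ ⟪x, y⟫ → l * r ^ 2 ≤ ⟪x, c⟫) :
    l ≤ k := by
  by_contra! hlt
  have hr2 : 0 < r ^ 2 := by positivity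
  have hyc : ⟪y, c⟫ ≤ r ^ 2 := by
    have := real_inner_le_norm y c
    rw [hy, hc] at this; nlinarith
  rcases lt_or_ge 0 l with hl | hl
  · have hm : max k 0 < l := max_lt hlt hl
    obtain ⟨x, hx, hxy, hxa⟩ := exists_at hd r hr y (-c) hy (max k 0)
      (le_trans hk (le_max_left _ _)) (by linarith)
    have h1 := h x hx (by rw [hxy]; gcongr; exact le_max_left _ _)
    rw [inner_neg_right, inner_neg_right] at hxa
    have h2 : max k 0 * ⟪y, c⟫ ≤ max k 0 * r ^ 2 :=
      mul_le_mul_of_nonneg_left hyc (le_max_right _ _)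
    have h3 : max k 0 * r ^ 2 < l * r ^ 2 := by gcongr
    linarith
  · obtain ⟨x, hx, hxy, hxa⟩ := exists_at hd r hr c y hc ((k + l) / 2)
      (by linarith) (by linarith)
    rw [real_inner_comm] at hyc
    have h2 : (k + l) / 2 * r ^ 2 ≤ (k + l) / 2 * ⟪c, y⟫ :=
      mul_le_mul_of_nonpos_left hyc (by linarith)
    have h1 := h x hx (by nlinarith)
    rw [hxy] at h1
    nlinarith

lemma proj_sub_cap {d : ℕ} (r : ℝ) (O z : EuclideanSpace ℝ (Fin d)) (ρ : ℝ)
    (hz : ‖z‖ = r) (hρ : 0 < ρ) (hD : ρ < ‖O - z‖) :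
    ∃ c : EuclideanSpace ℝ (Fin d), ‖c‖ = r ∧ ∀ x ∈ sphProj r (closedBall O ρ) z,
      (1 - 2 * (ρ / ‖O - z‖) ^ 2) * r ^ 2 ≤ ⟪x, c⟫ := by
  have hr : 0 ≤ r := hz ▸ norm_nonneg z
  set p := O - z with hp
  have hD0 : 0 < ‖p‖ := hρ.trans hD
  refine ⟨z - (2 * ⟪z, p⟫ / ‖p‖ ^ 2) • p, ?_, ?_⟩
  · rw [← sq_eq_sq₀ (norm_nonneg _) hr, norm_sub_sq_real, norm_smul, inner_smul_right, mul_pow,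
      Real.norm_eq_abs, sq_abs, hz]
    field_simp
    ring
  · rintro x ⟨hx, y, ⟨a, b, ha, hb, hab, rfl⟩, hy⟩
    obtain ⟨q, rfl⟩ : ∃ q, x = z + q := ⟨x - z, by simp⟩
    have e1 : O - (a • (z + q) + b • z) = p - a • q := by
      have : b = 1 - a := by linarith
      rw [this, hp]; module
    rw [mem_closedBall, dist_comm, dist_eq_norm, e1] at hy
    clear e1
    clear_value p
    have hy2 : ‖p - a • q‖ ^ 2 ≤ ρ ^ 2 := by gcongr
    rw [norm_sub_sq_real, norm_smul, inner_smul_right, mul_pow, Real.norm_eq_abs, sq_abs] at hy2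
    have hx2 : ‖z + q‖ ^ 2 = r ^ 2 := by rw [hx]
    rw [norm_add_sq_real, hz] at hx2
    have hG := gram3_nonneg z p q
    simp only [real_inner_self_eq_norm_sq] at hG
    rw [hz] at hG
    have hQ : 0 < ‖q‖ ^ 2 := by
      have : q ≠ 0 := by
        rintro rfl
        simp at hy
        linarith
      have := norm_pos_iff.2 this
      positivity
    rw [inner_add_left, inner_sub_right, inner_sub_right, inner_smul_right, inner_smul_right,
      real_inner_self_eq_norm_sq, hz, real_inner_comm z q, real_inner_comm p q]
    have hzq : ⟪z, q⟫ = - (‖q‖ ^ 2 / 2) := by linarith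
    rw [hzq] at hG ⊢
    have hP : 0 < ‖p‖ ^ 2 := by positivity
    have hr2 : 0 ≤ r ^ 2 := by positivity
    rw [div_pow]
    generalize ‖q‖ ^ 2 = Q at *
    generalize ‖p‖ ^ 2 = P at *
    generalize r ^ 2 = R at *
    generalize ⟪z, p⟫ = A at *
    generalize ⟪p, q⟫ = k at *
    have h1 : P * Q - k ^ 2 ≤ ρ ^ 2 * Q := by nlinarith [sq_nonneg (k - a * Q)]
    have h2 : R * (P * Q - k ^ 2) ≤ R * (ρ ^ 2 * Q) := by gcongr
    have h3 : 0 ≤ Q * (R * ρ ^ 2 - A ^ 2 - Q * P / 4 - A * k) := by nlinarith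
    have h4 := nonneg_of_mul_nonneg_right h3 hQ
    rw [← sub_nonneg]
    have h5 : R - 2 * A / P * A + (-(Q / 2) - 2 * A / P * k) - (1 - 2 * (ρ ^ 2 / P)) * R
       = 2 * (R * ρ ^ 2 - A ^ 2 - Q * P / 4 - A * k) / P := by
      field_simp
      ring
    first
      | (rw [h5]; positivity)
      | (have : 0 ≤ 2 * (R * ρ ^ 2 - A ^ 2 - Q * P / 4 - A * k) / P := by positivity
         linarith)

lemma cap_sub_proj {d : ℕ} (r : ℝ) (hr : 0 < r) (O z : EuclideanSpace ℝ (Fin d)) (ρ μ : ℝ)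
    (hz : ‖z‖ = r) (hρ : 0 < ρ) (hO : O = μ • z) (hOr : ‖O‖ < r)
    (x : EuclideanSpace ℝ (Fin d)) (hx : ‖x‖ = r)
    (h : (1 - 2 * (ρ / ‖O - z‖) ^ 2) * r ^ 2 ≤ ⟪x, -z⟫) :
    x ∈ sphProj r (closedBall O ρ) z := by
  have hμ : |μ| < 1 := by
    rw [hO, norm_smul, hz, Real.norm_eq_abs] at hOr
    nlinarith
  obtain ⟨h1, h2⟩ := abs_lt.1 hμ
  refine ⟨hx, z + ((1 - μ) / 2) • (x - z), ⟨(1 - μ) / 2, 1 - (1 - μ) / 2, by linarith,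
    by linarith, by ring, by module⟩, ?_⟩
  have e : z + ((1 - μ) / 2) • (x - z) - O = ((1 - μ) / 2) • (x + z) := by rw [hO]; module
  have eD : ‖O - z‖ = (1 - μ) * r := by
    have : O - z = (-(1 - μ)) • z := by rw [hO]; module
    rw [this, norm_smul, norm_neg, Real.norm_of_nonneg (by linarith), hz]
  rw [mem_closedBall, dist_eq_norm, e]
  apply le_of_sq_le_sq _ hρ.le
  rw [norm_smul, mul_pow, Real.norm_eq_abs, sq_abs, norm_add_sq_real, hx, hz]
  rw [eD, inner_neg_right] at h
  have hm : 0 < 1 - μ := by linarith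
  have e2 : (1 - 2 * (ρ / ((1 - μ) * r)) ^ 2) * r ^ 2 = r ^ 2 - 2 * ρ ^ 2 / (1 - μ) ^ 2 := by
    field_simp
  rw [e2] at h
  have h3 : r ^ 2 + ⟪x, z⟫ ≤ 2 * ρ ^ 2 / (1 - μ) ^ 2 := by linarith
  rw [le_div_iff₀ (by positivity)] at h3
  nlinarith

lemma key {d : ℕ} (hd : 2 ≤ d) (r : ℝ) (hr : 0 < r)
    (OK OL : EuclideanSpace ℝ (Fin d)) (rK rL : ℝ) (hrK : 0 < rK) (hrL : 0 < rL)
    (hKr : closedBall OK rK ⊆ ball 0 r) (hLr : closedBall OL rL ⊆ ball 0 r)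
    (hcong : ∀ z : EuclideanSpace ℝ (Fin d), ‖z‖ = r →
      ∃ φ : EuclideanSpace ℝ (Fin d) ≃ₗᵢ[ℝ] EuclideanSpace ℝ (Fin d),
        φ '' sphProj r (closedBall OK rK) z = sphProj r (closedBall OL rL) z)
    (z : EuclideanSpace ℝ (Fin d)) (hz : ‖z‖ = r) (μ : ℝ) (hO : OK = μ • z) :
    rK ^ 2 * ‖OL - z‖ ^ 2 ≤ rL ^ 2 * ‖OK - z‖ ^ 2 := by
  have hOr : ‖OK‖ < r := by simpa using hKr (mem_closedBall_self hrK.le)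
  have hDL : rL < ‖OL - z‖ := by
    by_contra! h
    have := hLr (show z ∈ closedBall OL rL by rwa [mem_closedBall, dist_comm, dist_eq_norm])
    simp [hz] at this
  have hDK : rK < ‖OK - z‖ := by
    by_contra! h
    have := hKr (show z ∈ closedBall OK rK by rwa [mem_closedBall, dist_comm, dist_eq_norm])
    simp [hz] at this
  obtain ⟨c, hc, hcap⟩ := proj_sub_cap r OL z rL hz hrL hDL
  obtain ⟨φ, hφ⟩ := hcong z hz
  have hK0 := hrK.trans hDK
  have hL0 := hrL.trans hDL
  have h := cap_mono hd r hr (φ (-z)) c (by rw [φ.norm_map, norm_neg, hz]) hc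
    (1 - 2 * (rK / ‖OK - z‖) ^ 2) (1 - 2 * (rL / ‖OL - z‖) ^ 2) ?_ ?_ ?_
  · have h' : (rK / ‖OK - z‖) ^ 2 ≤ (rL / ‖OL - z‖) ^ 2 := by linarith
    rw [div_pow, div_pow, div_le_div_iff₀ (by positivity) (by positivity)] at h'
    exact h'
  · have : (rK / ‖OK - z‖) ^ 2 ≤ 1 := by
      rw [sq_le_one_iff₀ (by positivity), div_le_one hK0]; exact hDK.le
    linarith
  · have := sq_nonneg (rL / ‖OL - z‖)
    linarith
  · intro x hx hxy
    apply hcap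
    rw [← hφ]
    refine ⟨φ.symm x, ?_, by simp⟩
    apply cap_sub_proj r hr OK z rK μ hz hrK hO hOr _ (by rw [φ.symm.norm_map, hx])
    rw [← φ.inner_map_map, φ.apply_symm_apply]
    exact hxy

lemma key2 {d : ℕ} (hd : 2 ≤ d) (r : ℝ) (hr : 0 < r)
    (OK OL : EuclideanSpace ℝ (Fin d)) (rK rL : ℝ) (hrK : 0 < rK) (hrL : 0 < rL)
    (hKr : closedBall OK rK ⊆ ball 0 r) (hLr : closedBall OL rL ⊆ ball 0 r)
    (hcong : ∀ z : EuclideanSpace ℝ (Fin d), ‖z‖ = r →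
      ∃ φ : EuclideanSpace ℝ (Fin d) ≃ₗᵢ[ℝ] EuclideanSpace ℝ (Fin d),
        φ '' sphProj r (closedBall OK rK) z = sphProj r (closedBall OL rL) z) :
    ∃ (z : EuclideanSpace ℝ (Fin d)) (μ : ℝ), OK = μ • z ∧
      rK ^ 2 * (‖OL‖ ^ 2 + r ^ 2) - rL ^ 2 * (‖OK‖ ^ 2 + r ^ 2)
        ≤ - |2 * (rK ^ 2 * ⟪OL, z⟫ - rL ^ 2 * ⟪OK, z⟫)| := by
  obtain ⟨z, μ, hz, hO⟩ : ∃ (z : EuclideanSpace ℝ (Fin d)) (μ : ℝ), ‖z‖ = r ∧ OK = μ • z := by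
    by_cases h : OK = 0
    · obtain ⟨w, hw, -⟩ := exists_perp hd r hr 0 0
      exact ⟨w, 0, hw, by simp [h]⟩
    · have := norm_pos_iff.2 h
      refine ⟨(r / ‖OK‖) • OK, ‖OK‖ / r, ?_, ?_⟩
      · rw [norm_smul, Real.norm_of_nonneg (by positivity)]; field_simp
      · rw [smul_smul, div_mul_div_cancel₀ hr.ne', div_self this.ne', one_smul]
  refine ⟨z, μ, hO, ?_⟩
  have h1 := key hd r hr OK OL rK rL hrK hrL hKr hLr hcong z hz μ hO
  have h2 := key hd r hr OK OL rK rL hrK hrL hKr hLr hcong (-z) (by rw [norm_neg, hz]) (-μ)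
    (by rw [hO]; module)
  rw [norm_sub_sq_real, norm_sub_sq_real, hz] at h1
  rw [norm_sub_sq_real, norm_sub_sq_real, inner_neg_right, inner_neg_right, norm_neg, hz] at h2
  rw [le_neg, abs_le]
  constructor <;> linarith

theorem stmt1 (d : ℕ) (hd : 2 ≤ d) (r : ℝ) (hr : 0 < r)
    (OK OL : EuclideanSpace ℝ (Fin d)) (rK rL : ℝ) (hrK : 0 < rK) (hrL : 0 < rL)
    (K L : Set (EuclideanSpace ℝ (Fin d)))
    (hK : K = closedBall OK rK) (hL : L = closedBall OL rL)
    (hKr : K ⊆ ball 0 r) (hLr : L ⊆ ball 0 r)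
    (hcong : ∀ z : EuclideanSpace ℝ (Fin d), ‖z‖ = r →
      ∃ φ : EuclideanSpace ℝ (Fin d) ≃ₗᵢ[ℝ] EuclideanSpace ℝ (Fin d),
        φ '' sphProj r K z = sphProj r L z) :
    K = L := by
  subst hK hL
  have hOK : ‖OK‖ < r := by simpa using hKr (mem_closedBall_self hrK.le)
  have hOL : ‖OL‖ < r := by simpa using hLr (mem_closedBall_self hrL.le)
  obtain ⟨z, μ, hz, h1⟩ := key2 hd r hr OK OL rK rL hrK hrL hKr hLr hcong
  obtain ⟨y, ν, hy, h2⟩ := key2 hd r hr OL OK rL rK hrL hrK hLr hKr (by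
    intro z hz
    obtain ⟨φ, hφ⟩ := hcong z hz
    refine ⟨φ.symm, ?_⟩
    rw [← hφ, image_image]
    simp)
  have a1 := abs_nonneg (2 * (rK ^ 2 * ⟪OL, z⟫ - rL ^ 2 * ⟪OK, z⟫))
  have a2 := abs_nonneg (2 * (rL ^ 2 * ⟪OK, y⟫ - rK ^ 2 * ⟪OL, y⟫))
  have b1 := abs_eq_zero.1 (le_antisymm (by linarith) a1)
  have b2 := abs_eq_zero.1 (le_antisymm (by linarith) a2)
  have hS : rK ^ 2 * (‖OL‖ ^ 2 + r ^ 2) = rL ^ 2 * (‖OK‖ ^ 2 + r ^ 2) := by linarith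
  have hv1 : ⟪rK ^ 2 • OL - rL ^ 2 • OK, OK⟫ = 0 := by
    have : ⟪rK ^ 2 • OL - rL ^ 2 • OK, z⟫ = 0 := by
      rw [inner_sub_left, real_inner_smul_left, real_inner_smul_left]; linarith
    nth_rewrite 2 [hz]
    rw [inner_smul_right, this, mul_zero]
  have hv2 : ⟪rK ^ 2 • OL - rL ^ 2 • OK, OL⟫ = 0 := by
    have : ⟪rK ^ 2 • OL - rL ^ 2 • OK, y⟫ = 0 := by
      rw [inner_sub_left, real_inner_smul_left, real_inner_smul_left]; linarith
    nth_rewrite 2 [hy]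
    rw [inner_smul_right, this, mul_zero]
  have hv : rK ^ 2 • OL - rL ^ 2 • OK = 0 := by
    rw [← inner_self_eq_zero (𝕜 := ℝ)]
    nth_rewrite 2 [sub_eq_add_neg]
    rw [inner_add_right, inner_neg_right, real_inner_smul_right, real_inner_smul_right, hv1, hv2]
    simp
  have hv' : rK ^ 2 • OL = rL ^ 2 • OK := sub_eq_zero.1 hv
  have hn : rK ^ 2 * ‖OL‖ = rL ^ 2 * ‖OK‖ := by
    have := congrArg norm hv'
    rwa [norm_smul, norm_smul, Real.norm_of_nonneg (by positivity),
      Real.norm_of_nonneg (by positivity)] at this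
  have hA : 0 < rK ^ 2 := by positivity
  have hB : 0 < rL ^ 2 := by positivity
  have hAB : rK ^ 2 = rL ^ 2 := by
    have hm := norm_nonneg OK
    have hl := norm_nonneg OL
    generalize rK ^ 2 = A at *
    generalize rL ^ 2 = B at *
    generalize ‖OK‖ = m at *
    generalize ‖OL‖ = n at *
    have e1 : (A - B) * (B * m ^ 2 - A * r ^ 2) = 0 := by
      linear_combination (-A) * hS + (A * n + B * m) * hn
    rcases mul_eq_zero.1 e1 with h | h
    · linarith
    · have e2 : A * (A * n ^ 2 - B * r ^ 2) = 0 := by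
        linear_combination (A * n + B * m) * hn + B * h
      have e3 : A * n ^ 2 - B * r ^ 2 = 0 := (mul_eq_zero.1 e2).resolve_left hA.ne'
      have c1 : m ^ 2 < r ^ 2 := by gcongr
      have c2 : n ^ 2 < r ^ 2 := by gcongr
      have d1 : B * m ^ 2 < B * r ^ 2 := by gcongr
      have d2 : A * n ^ 2 < A * r ^ 2 := by gcongr
      linarith
  have hrr : rK = rL := (sq_eq_sq₀ hrK.le hrL.le).1 hAB
  rw [← hAB] at hv'
  have hOO : OL = OK := smul_right_injective _ hA.ne' hv'
  rw [hrr, hOO]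
end

section
/- Let z ∈ rS^{d-1} and let x, y, p, q be points in the open ball rB^d with x ≠ y, p ≠ q. Suppose there is φ ∈ O(d) mapping the arc (xy)_z (the spherical projection of segment xy from z) onto the arc (pq)_z. Then the circles Π(x,y,z) ∩ rS^{d-1} and Π(p,q,z) ∩ rS^{d-1} have equal radii, and ∠xzy = ∠pzq, where Π(a,b,c) denotes the 2-plane through a, b, c. -/
open Metric Set EuclideanGeometry

lemma capR (ρ h h' c d : ℝ) (hρ : 0 < ρ) (h1 : -ρ < h) (h2 : h < ρ)
    (hcd : c^2 + d^2 = 1) (h3 : -ρ < h')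
    (H : ∀ a b : ℝ, a^2 + b^2 = ρ^2 → h ≤ a → h' ≤ c*a + d*b) : h' ≤ h := by
  obtain ⟨s, hs0, hs⟩ : ∃ s : ℝ, 0 < s ∧ s^2 = ρ^2 - h^2 :=
    ⟨Real.sqrt (ρ^2-h^2), Real.sqrt_pos.2 (by nlinarith), Real.sq_sqrt (by nlinarith)⟩
  have hc1 : c ≤ 1 := by nlinarith [sq_nonneg d, sq_nonneg (c-1)]
  have key : h' ≤ c*h - s*|d| := by
    rcases abs_cases d with ⟨e, _⟩ | ⟨e, _⟩
    · have := H h (-s) (by nlinarith) le_rfl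
      rw [e]; linarith
    · have := H h s (by nlinarith) le_rfl
      rw [e]; linarith
  have hd0 := abs_nonneg d
  have hd2 : |d|^2 = 1 - c^2 := by rw [sq_abs]; linarith
  by_cases hh : 0 ≤ h
  · nlinarith [mul_nonneg hs0.le hd0, mul_nonneg hh (sub_nonneg.2 hc1)]
  · push Not at hh
    by_cases hm : h ≤ -ρ*c
    · have := H (-ρ*c) (-ρ*d) (by linear_combination ρ^2*hcd) hm
      nlinarith
    · push Not at hm
      have hc0 : 0 < c := by
        by_contra hc; push Not at hc; nlinarith
      have hds : ρ * |d| ≤ s := by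
        refine (sq_le_sq₀ (by positivity) hs0.le).1 ?_
        nlinarith
      have : (-h)*(1-c) ≤ s*|d| := by
        calc (-h)*(1-c) ≤ ρ*(1-c) := by
              apply mul_le_mul_of_nonneg_right <;> linarith
          _ ≤ ρ*(1-c)*(1+c) := by
              nlinarith [mul_nonneg hρ.le (mul_nonneg (sub_nonneg.2 hc1) hc0.le)]
          _ = ρ * |d| * |d| := by linear_combination -ρ*hd2
          _ ≤ s * |d| := mul_le_mul_of_nonneg_right hds hd0
      nlinarith

/-- cone points on the circle lie beyond the chord -/
lemma fwdR (s t C α β : ℝ) (hs : 0 < s) (ht : 0 < t) (hC : C < 1)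
    (hα : 0 ≤ α) (hβ : 0 ≤ β) (h0 : α ≠ 0 ∨ β ≠ 0)
    (hq : α^2 + β^2 + 2*C*α*β - s*α - t*β = 0) : s*t ≤ α*t + β*s := by
  by_contra hlt
  push Not at hlt
  obtain ⟨a, rfl⟩ : ∃ a, α = s*a := ⟨α/s, by field_simp⟩
  obtain ⟨b, rfl⟩ : ∃ b, β = t*b := ⟨β/t, by field_simp⟩
  have ha : 0 ≤ a := by
    by_contra h; push Not at h; nlinarith
  have hb : 0 ≤ b := by
    by_contra h; push Not at h; nlinarith
  have hab : a + b < 1 := by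
    have : (s*t)*(a+b) < (s*t)*1 := by linarith
    exact lt_of_mul_lt_mul_left this (by positivity)
  have e : s^2*(a*(1-a)) + t^2*(b*(1-b)) = 2*C*(s*t)*(a*b) := by linear_combination -hq
  have p1 : s^2*(a*b) ≤ s^2*(a*(1-a)) := by gcongr; linarith
  have p2 : t^2*(a*b) ≤ t^2*(b*(1-b)) := by
    rw [mul_comm a b]; gcongr; linarith
  have p3 : 2*C*(s*t)*(a*b) ≤ 2*1*(s*t)*(a*b) := by gcongr
  have p4 : 0 ≤ (s-t)^2*(a*b) := by positivity
  rcases h0 with h0 | h0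
  · have ha' : 0 < a := lt_of_le_of_ne ha (by rintro rfl; simp at h0)
    have : s^2*(a*b) < s^2*(a*(1-a)) := by gcongr; linarith
    nlinarith
  · have hb' : 0 < b := lt_of_le_of_ne hb (by rintro rfl; simp at h0)
    have : t^2*(a*b) < t^2*(b*(1-b)) := by
      rw [mul_comm a b]; gcongr; linarith
    nlinarith

lemma bwdR (s t C α β : ℝ) (hs : 0 < s) (ht : 0 < t) (hC : C < 1)
    (hq : α^2 + β^2 + 2*C*α*β - s*α - t*β = 0) (h : s*t ≤ α*t + β*s) : 0 ≤ α := by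
  by_contra hlt
  push Not at hlt
  obtain ⟨a, rfl⟩ : ∃ a, α = -(s*a) := ⟨-α/s, by field_simp⟩
  obtain ⟨b, rfl⟩ : ∃ b, β = t*b := ⟨β/t, by field_simp⟩
  have ha : 0 < a := by
    by_contra h; push Not at h; nlinarith
  have hab : 1 + a ≤ b := by
    have : (s*t)*(1+a) ≤ (s*t)*b := by linarith
    exact le_of_mul_le_mul_left this (by positivity)
  have e : s^2*(a*(1+a)) + t^2*(b*(b-1)) - 2*C*(s*t)*(a*b) = 0 := by linear_combination hq
  -- multiply by a*(1+a)
  have hD : a*b ≤ (1+a)*(b-1) := by nlinarith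
  have h1 : 2*C*(s*t)*(a*b) < 2*1*(s*t)*(a*b) := by
    have : 0 < b := by linarith
    gcongr
  have h2 : 0 ≤ (s*(a*(1+a)) - t*(a*b))^2 := sq_nonneg _
  have h3 : (a*b)*(a*b) ≤ (a*b)*((1+a)*(b-1)) := by
    apply mul_le_mul_of_nonneg_left hD
    have : 0 < b := by linarith
    positivity
  have h4 : t^2*((a*b)*(a*b)) ≤ t^2*((a*b)*((1+a)*(b-1))) := by gcongr
  have h5 : 0 < (a*(1+a)) * (2*(s*t)*(a*b) - 2*C*(s*t)*(a*b)) :=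
    mul_pos (by positivity) (by linarith)
  have : (a*(1+a)) * (s^2*(a*(1+a)) + t^2*(b*(b-1)) - 2*C*(s*t)*(a*b)) = 0 := by
    rw [e, mul_zero]
  nlinarith

section
variable {E : Type*} [NormedAddCommGroup E] [InnerProductSpace ℝ E]

structure IsFr (c n m : E) : Prop where
  nn : inner ℝ n n = 1
  mm : inner ℝ m m = 1
  nm : inner ℝ n m = 0
  cn : inner ℝ c n = 0
  cm : inner ℝ c m = 0

lemma IsFr.normsq {c n m : E} (F : IsFr c n m) (a b : ℝ) :
    ‖c + a•n + b•m‖^2 = ‖c‖^2 + a^2 + b^2 := by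
  have h1 := F.nm; have h2 := F.cn; have h3 := F.cm
  have h1' := F.nm; have h2' := F.cn; have h3' := F.cm
  rw [real_inner_comm] at h1' h2' h3'
  rw [← real_inner_self_eq_norm_sq, ← real_inner_self_eq_norm_sq]
  simp only [inner_add_left, inner_add_right, real_inner_smul_left, real_inner_smul_right,
    F.nn, F.mm, h1, h2, h3, h1', h2', h3']
  ring

def capS (c n m : E) (ρ h : ℝ) : Set E := {u | ∃ a b : ℝ, a^2+b^2 = ρ^2 ∧ h ≤ a ∧ u = c + a•n + b•m}

lemma cap_sub {c n m c' n' m' : E} {ρ h ρ' h' : ℝ} (h1 : -ρ < h) (h2 : h < ρ)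
    (hs : capS c n m ρ h ⊆ capS c' n' m' ρ' h') :
    (∃ a b : ℝ, n = a•n' + b•m') ∧ (∃ a b : ℝ, m = a•n' + b•m') ∧ 
    (∃ a b : ℝ, c = c' + a•n' + b•m') := by
  obtain ⟨s, hs0, hss⟩ : ∃ s : ℝ, 0 < s ∧ s^2 = ρ^2 - h^2 :=
    ⟨Real.sqrt (ρ^2-h^2), Real.sqrt_pos.2 (by nlinarith), Real.sq_sqrt (by nlinarith)⟩
  obtain ⟨a0, b0, -, -, e0⟩ := hs (show c + ρ•n + (0:ℝ)•m ∈ _ from ⟨ρ, 0, by ring, h2.le, rfl⟩)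
  obtain ⟨a1, b1, -, -, e1⟩ := hs (show c + h•n + s•m ∈ _ from ⟨h, s, by linarith, le_rfl, rfl⟩)
  obtain ⟨a2, b2, -, -, e2⟩ := hs (show c + h•n + (-s)•m ∈ _ from ⟨h, -s, by linarith, le_rfl, rfl⟩)
  have hm : m = ((a1-a2)/(2*s))•n' + ((b1-b2)/(2*s))•m' := by
    have : (2*s)•m = (a1-a2)•n' + (b1-b2)•m' := by
      linear_combination (norm := module) e1 - e2
    rw [← inv_smul_smul₀ (show (2*s) ≠ 0 by positivity) m, this]
    module
  have hn : n = ((a0-(a1+a2)/2)/(ρ-h))•n' + ((b0-(b1+b2)/2)/(ρ-h))•m' := by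
    have : (ρ-h)•n = (a0-(a1+a2)/2)•n' + (b0-(b1+b2)/2)•m' := by
      linear_combination (norm := module) e0 - (1/2:ℝ)•e1 - (1/2:ℝ)•e2
    rw [← inv_smul_smul₀ (show (ρ-h) ≠ 0 by linarith) n, this]
    module
  refine ⟨⟨_, _, hn⟩, ⟨_, _, hm⟩, a0 - ρ*((a0-(a1+a2)/2)/(ρ-h)), b0 - ρ * ((b0-(b1+b2)/2)/(ρ-h)), ?_⟩
  have e3 : c = c' + a0•n' + b0•m' - ρ•n := by rw [← e0]; module
  rw [e3]; nth_rw 1 [hn]; module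

lemma cap_le {c n m n' m' : E} {ρ h h' : ℝ} (F : IsFr c n m) (F' : IsFr c n' m') (hρ : 0 < ρ)
    (h1 : -ρ < h) (h2 : h < ρ) (h3 : -ρ < h')
    (hs : capS c n m ρ h ⊆ capS c n' m' ρ h') : h' ≤ h := by
  obtain ⟨a0, b0, hn⟩ := (cap_sub h1 h2 hs).1
  obtain ⟨a1, b1, hm⟩ := (cap_sub h1 h2 hs).2.1
  have g0 := F.nn
  have g1 := F.mm
  have g2 := F.nm
  have h1' := F'.nm
  rw [real_inner_comm] at h1'
  rw [hn] at g0 g2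
  rw [hm] at g1 g2
  simp only [inner_add_left, inner_add_right, real_inner_smul_left, real_inner_smul_right,
    F'.nn, F'.mm, F'.nm, h1'] at g0 g1 g2
  -- a0^2+b0^2 = 1, a1^2+b1^2=1, a0 a1 + b0 b1 = 0, need a0^2+a1^2=1
  have g3 : a0^2 + a1^2 = 1 := by
    have e1 : a0*(a0*b1 - b0*a1) = b1 := by linear_combination b1*g0 - b0*g2
    have e2 : a1*(a0*b1 - b0*a1) = -b0 := by linear_combination b1*g2 - b0*g1
    have e3 : (a0*b1 - b0*a1)^2 = 1 := by
      linear_combination a0*a0*g1 + b0*b0*g1+ g0 - (a0*a1+b0*b1)*g2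
    linear_combination g1 + (a0*(a0*b1 - b0*a1)+b1)*e1 - a0^2*e3
  refine capR ρ h h' a0 a1 hρ h1 h2 g3 h3 ?_
  intro a b hab ha
  obtain ⟨a', b', -, hh, e⟩ := hs (show c + a•n + b•m ∈ _ from ⟨a, b, hab, ha, rfl⟩)
  have := congrArg (fun v => inner ℝ v n') e
  simp only [hn, hm, inner_add_left, inner_add_right, real_inner_smul_left, real_inner_smul_right,
    F'.nn, F'.mm, F'.nm, F'.cn, h1'] at this
  linarith

lemma cap_center {c n m c' n' m' : E} (F : IsFr c n m) (F' : IsFr c' n' m') 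
    (h1 : ∃ a b : ℝ, n' = a•n + b•m) (h2 : ∃ a b : ℝ, m' = a•n + b•m)
    (h3 : ∃ a b : ℝ, c = c' + a•n' + b•m') : c = c' := by
  obtain ⟨a0, b0, hn⟩ := h1
  obtain ⟨a1, b1, hm⟩ := h2
  obtain ⟨a, b, hc⟩ := h3
  have k1 : inner ℝ c n' = 0 := by
    rw [hn]; simp [inner_add_right, real_inner_smul_right, F.cn, F.cm]
  have k2 : inner ℝ c m' = 0 := by
    rw [hm]; simp [inner_add_right, real_inner_smul_right, F.cn, F.cm]
  have h1' := F'.nm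
  rw [real_inner_comm] at h1'
  rw [hc] at k1 k2
  simp only [inner_add_left, real_inner_smul_left, F'.cn, F'.cm, F'.nm, F'.nn, F'.mm, h1', mul_zero, mul_one, zero_add, add_zero] at k1 k2
  rw [hc, k1, k2]; simp

lemma cap_eq {c n m c' n' m' : E} {ρ h ρ' h' r : ℝ} (F : IsFr c n m) (F' : IsFr c' n' m')
    (hρ : 0 < ρ) (hρ' : 0 < ρ') (hr : ‖c‖^2 + ρ^2 = r^2) (hr' : ‖c'‖^2 + ρ'^2 = r^2)
    (h1 : -ρ < h) (h2 : h < ρ) (h3 : -ρ' < h') (h4 : h' < ρ')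
    (hs : capS c n m ρ h = capS c' n' m' ρ' h') : c = c' ∧ ρ = ρ' ∧ h = h' := by
  obtain ⟨s1, s2, s3⟩ := cap_sub h1 h2 hs.subset
  obtain ⟨t1, t2, t3⟩ := cap_sub h3 h4 hs.superset
  obtain rfl := cap_center F F' t1 t2 s3
  have : ρ = ρ' := by
    have : ρ^2 = ρ'^2 := by linarith
    exact (pow_left_inj₀ hρ.le hρ'.le two_ne_zero).1 this
  subst this
  exact ⟨rfl, rfl, le_antisymm (cap_le F' F hρ h3 h4 h1 hs.superset) (cap_le F F' hρ h1 h2 h3 hs.subset)⟩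

/-- frame adapted to the cone spanned by unit vectors `e`, `f` at `z`. -/
lemma exists_frame (e f z : E) (C s t r : ℝ) (hee : inner ℝ e e = (1:ℝ)) (hff : inner ℝ f f = (1:ℝ))
    (hef : inner ℝ e f = C) (hC : C^2 < 1) (hs : 0 < s) (ht : 0 < t)
    (hze : 2 * inner ℝ z e = -s) (hzf : 2 * inner ℝ z f = -t) (hz : ‖z‖ = r) :
    ∃ (c n m : E) (ρ k : ℝ), IsFr c n m ∧ 0 < ρ ∧ 0 < k ∧ ‖c‖^2 + ρ^2 = r^2 ∧
      (∃ α β : ℝ, c = z + α•e + β•f) ∧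
      (∀ α β : ℝ, ∃ a b : ℝ, z + α•e + β•f = c + a•n + b•m ∧ a - ρ*C = k*(α*t+β*s-s*t)) ∧
      (∀ a b : ℝ, ∃ α β : ℝ, c + a•n + b•m = z + α•e + β•f ∧ a - ρ*C = k*(α*t+β*s-s*t)) := by
  obtain ⟨S, hS0, hS⟩ : ∃ S : ℝ, 0 < S ∧ S^2 = 1 - C^2 :=
    ⟨Real.sqrt (1-C^2), Real.sqrt_pos.2 (by linarith), Real.sq_sqrt (by linarith)⟩
  have hC1 : C < 1 := by nlinarith
  have hDp : 0 < s^2+t^2-2*s*t*C := by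
    nlinarith [mul_pos (mul_pos hs ht) (sub_pos.2 hC1), sq_nonneg (s-t)]
  obtain ⟨D, hD0, hD⟩ : ∃ D : ℝ, 0 < D ∧ D^2 = s^2+t^2-2*s*t*C :=
    ⟨Real.sqrt _, Real.sqrt_pos.2 hDp, Real.sq_sqrt hDp.le⟩
  have hfe : inner ℝ f e = C := by rw [real_inner_comm]; exact hef
  have hze' : inner ℝ z e = -s/2 := by linarith
  have hzf' : inner ℝ z f = -t/2 := by linarith
  set α0 := (s-t*C)/(2*S^2) with hα0
  set β0 := (t-s*C)/(2*S^2) with hβ0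
  set c := z + α0•e + β0•f with hc
  set n := ((t-s*C)/(S*D))•e + ((s-t*C)/(S*D))•f with hn
  set m := (s/D)•e + (-t/D)•f with hm
  have he : e = (t*S/D)•n + ((s-t*C)/D)•m := by
    have h1 : t*S/D*((t-s*C)/(S*D)) + (s-t*C)/D*(s/D) = 1 := by
      field_simp; linear_combination -hD
    have h2 : t*S/D*((s-t*C)/(S*D)) + (s-t*C)/D*(-t/D) = 0 := by
      field_simp; ring
    calc e = (1:ℝ)•e + (0:ℝ)•f := by module
      _ = _ := by rw [← h1, ← h2, hn, hm]; module
  have hf : f = (s*S/D)•n + ((s*C-t)/D)•m := by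
    have h1 : s*S/D*((t-s*C)/(S*D)) + (s*C-t)/D*(s/D) = 0 := by
      field_simp; ring
    have h2 : s*S/D*((s-t*C)/(S*D)) + (s*C-t)/D*(-t/D) = 1 := by
      field_simp; linear_combination -hD
    calc f = (0:ℝ)•e + (1:ℝ)•f := by module
      _ = _ := by rw [← h1, ← h2, hn, hm]; module
  have hce : inner ℝ c e = 0 := by
    simp only [hc, inner_add_left, real_inner_smul_left, hze', hee, hfe, hα0, hβ0]
    field_simp; linear_combination -s*hS
  have hcf : inner ℝ c f = 0 := by
    simp only [hc, inner_add_left, real_inner_smul_left, hzf', hff, hef, hα0, hβ0]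
    field_simp; linear_combination -t*hS
  have F : IsFr c n m := by
    refine ⟨?_, ?_, ?_, ?_, ?_⟩
    · simp only [hn, inner_add_left, inner_add_right, real_inner_smul_left, real_inner_smul_right,
        hee, hff, hef, hfe]
      field_simp
      rw [hS, hD]; ring
    · simp only [hm, inner_add_left, inner_add_right, real_inner_smul_left, real_inner_smul_right,
        hee, hff, hef, hfe]
      field_simp
      rw [hD]; ring
    · simp only [hn, hm, inner_add_left, inner_add_right, real_inner_smul_left,
        real_inner_smul_right, hee, hff, hef, hfe]
      field_simp
      ring
    · simp [hn, inner_add_right, real_inner_smul_right, hce, hcf]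
    · simp [hm, inner_add_right, real_inner_smul_right, hce, hcf]
  have conv : ∀ α β : ℝ, z + α•e + β•f =
      c + ((α-α0)*(t*S/D) + (β-β0)*(s*S/D))•n + ((α-α0)*((s-t*C)/D)+(β-β0)*((s*C-t)/D))•m := by
    intro α β
    calc z + α•e + β•f = c + (α-α0)•e + (β-β0)•f := by rw [hc]; module
      _ = c + (α-α0)•((t*S/D)•n + ((s-t*C)/D)•m) + (β-β0)•((s*S/D)•n + ((s*C-t)/D)•m) := by
        rw [← he, ← hf]
      _ = _ := by module
  have hk : ∀ α β : ℝ, (α-α0)*(t*S/D) + (β-β0)*(s*S/D) - (D/(2*S))*C = S/D*(α*t+β*s-s*t) := by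
    intro α β
    rw [hα0, hβ0]
    field_simp
    rw [hD]
    linear_combination (2*s*t) * hS
  refine ⟨c, n, m, D/(2*S), S/D, F, by positivity, by positivity, ?_, ⟨α0, β0, rfl⟩, ?_, ?_⟩
  · have h1 := conv 0 0
    have h2 : z = z + (0:ℝ)•e + (0:ℝ)•f := by module
    rw [← h2] at h1
    rw [← hz]
    have h5 := F.normsq ((0-α0)*(t*S/D) + (0-β0)*(s*S/D)) ((0-α0)*((s-t*C)/D)+(0-β0)*((s*C-t)/D))
    rw [← h1] at h5
    rw [h5, hα0, hβ0]
    have h3 : ((0 - (s-t*C)/(2*S^2))*(t*S/D) + (0-(t-s*C)/(2*S^2))*(s*S/D)) = -(2*s*t-(s^2+t^2)*C)/(2*S*D) := by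
      field_simp; ring
    have h4 : ((0 - (s-t*C)/(2*S^2))*((s-t*C)/D) + (0-(t-s*C)/(2*S^2))*((s*C-t)/D)) = -(s^2-t^2)/(2*D) := by
      field_simp; rw [hS]; ring
    rw [h3, h4, add_assoc]
    congr 1
    have hD4 : D^4 = (s^2+t^2-2*s*t*C)^2 := by rw [← hD]; ring
    field_simp
    rw [hS, hD4]; ring
  · intro α β
    exact ⟨_, _, conv α β, hk α β⟩
  · intro a b
    refine ⟨α0 + a*((t-s*C)/(S*D)) + b*(s/D), β0 + a*((s-t*C)/(S*D)) + b*(-t/D), ?_, ?_⟩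
    · rw [hc, hn, hm]; module
    · rw [← hk]
      have : (α0 + a*((t-s*C)/(S*D)) + b*(s/D) - α0)*(t*S/D) + (β0 + a*((s-t*C)/(S*D)) + b*(-t/D) -β0)*(s*S/D) = a := by
        field_simp
        rw [hD]; ring
      rw [this]

end

set_option maxHeartbeats 2000000 in
lemma exists_cap {d : ℕ} (r : ℝ) (hr : 0 < r) (x y z : EuclideanSpace ℝ (Fin d))
    (hx : ‖x‖ < r) (hy : ‖y‖ < r) (hz : ‖z‖ = r)
    (hxyz : ¬ Collinear ℝ ({x, y, z} : Set (EuclideanSpace ℝ (Fin d)))) :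
    ∃ (c n m : EuclideanSpace ℝ (Fin d)) (ρ h : ℝ), IsFr c n m ∧ 0 < ρ ∧ -ρ < h ∧ h < ρ ∧
      ‖c‖^2 + ρ^2 = r^2 ∧ sphProj r (segment ℝ x y) z = capS c n m ρ h ∧
      h = ρ * Real.cos (∠ x z y) ∧
      Metric.infDist (0 : EuclideanSpace ℝ (Fin d))
        ((affineSpan ℝ ({x, y, z} : Set (EuclideanSpace ℝ (Fin d))) : AffineSubspace ℝ _) :
          Set (EuclideanSpace ℝ (Fin d))) = ‖c‖ := by
  have hzz : inner ℝ z z = r^2 := by rw [real_inner_self_eq_norm_sq, hz]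
  have inner_neg : ∀ w : EuclideanSpace ℝ (Fin d), ‖w‖ < r → inner ℝ z (w - z) < 0 := by
    intro w hw
    rw [inner_sub_right, hzz]
    have := real_inner_le_norm z w
    rw [hz] at this
    nlinarith
  have hX : 0 < ‖x - z‖ := by
    rw [norm_pos_iff, sub_ne_zero]; rintro rfl; linarith
  have hY : 0 < ‖y - z‖ := by
    rw [norm_pos_iff, sub_ne_zero]; rintro rfl; linarith
  set X := ‖x - z‖ with hXd
  set Y := ‖y - z‖ with hYd
  set e := X⁻¹ • (x - z) with he
  set f := Y⁻¹ • (y - z) with hf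
  have hxe : x - z = X • e := by rw [he, smul_inv_smul₀ hX.ne']
  have hyf : y - z = Y • f := by rw [hf, smul_inv_smul₀ hY.ne']
  have hee : inner ℝ e e = (1:ℝ) := by
    rw [he, real_inner_smul_left, real_inner_smul_right, real_inner_self_eq_norm_sq, ← hXd]
    field_simp
  have hff : inner ℝ f f = (1:ℝ) := by
    rw [hf, real_inner_smul_left, real_inner_smul_right, real_inner_self_eq_norm_sq, ← hYd]
    field_simp
  have hmemS : ∀ K : Submodule ℝ (EuclideanSpace ℝ (Fin d)), x - z ∈ K → e ∈ K :=
    fun K hK => K.smul_mem _ hK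
  have hmemT : ∀ K : Submodule ℝ (EuclideanSpace ℝ (Fin d)), y - z ∈ K → f ∈ K :=
    fun K hK => K.smul_mem _ hK
  clear_value e f X Y
  obtain ⟨C, hef⟩ : ∃ C : ℝ, inner ℝ e f = C := ⟨_, rfl⟩
  have hfe : inner ℝ f e = C := by rw [real_inner_comm]; exact hef
  have hcos : Real.cos (∠ x z y) = C := by
    rw [EuclideanGeometry.angle, InnerProductGeometry.cos_angle, vsub_eq_sub, vsub_eq_sub, ← hXd,
      ← hYd, hxe, hyf, real_inner_smul_left, real_inner_smul_right, hef]
    field_simp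
  have hCn : ‖f - C•e‖^2 = 1 - C^2 := by
    rw [← real_inner_self_eq_norm_sq]
    simp only [inner_sub_left, inner_sub_right, real_inner_smul_left, real_inner_smul_right,
      hee, hff, hef, hfe]
    ring
  have hC : C^2 < 1 := by
    by_contra hcon
    push Not at hcon
    have h0 : ‖f - C•e‖ = 0 := by
      have : ‖f - C•e‖^2 ≤ 0 := by linarith
      nlinarith [norm_nonneg (f - C•e)]
    rw [norm_eq_zero, sub_eq_zero] at h0
    apply hxyz
    rw [collinear_iff_of_mem (p₀ := z) (by simp)]
    refine ⟨e, ?_⟩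
    intro p hp
    simp only [mem_insert_iff, mem_singleton_iff] at hp
    rcases hp with rfl | rfl | rfl
    · exact ⟨X, by rw [vadd_eq_add, ← hxe]; simp⟩
    · exact ⟨Y * C, by rw [vadd_eq_add, mul_smul, ← h0, ← hyf]; simp⟩
    · exact ⟨0, by simp⟩
  have hC1 : C < 1 := by nlinarith
  have hC2 : -1 < C := by nlinarith
  obtain ⟨s, hs⟩ : ∃ s : ℝ, 2 * inner ℝ z e = -s := ⟨-(2 * inner ℝ z e), by ring⟩
  obtain ⟨t, ht⟩ : ∃ t : ℝ, 2 * inner ℝ z f = -t := ⟨-(2 * inner ℝ z f), by ring⟩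
  have hs0 : 0 < s := by
    have := inner_neg x hx
    rw [hxe, real_inner_smul_right] at this
    have : inner ℝ z e < 0 := by
      by_contra h; push Not at h; nlinarith
    linarith
  have ht0 : 0 < t := by
    have := inner_neg y hy
    rw [hyf, real_inner_smul_right] at this
    have : inner ℝ z f < 0 := by
      by_contra h; push Not at h; nlinarith
    linarith
  have hquad : ∀ α β : ℝ, ‖z + α•e + β•f‖ = r → α^2 + β^2 + 2*C*α*β - s*α - t*β = 0 := by
    intro α β h
    have h2 : ‖z + α•e + β•f‖^2 = r^2 := by rw [h]
    rw [← real_inner_self_eq_norm_sq] at h2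
    have hez := real_inner_comm z e
    have hfz := real_inner_comm z f
    simp only [inner_add_left, inner_add_right, real_inner_smul_left, real_inner_smul_right,
      hee, hff, hef, hfe, hzz, hez, hfz] at h2
    linear_combination h2 - α*hs - β*ht
  obtain ⟨c, n, m, ρ, k, F, hρ, hk, hcr, ⟨α0, β0, hc0⟩, hfwd, hbwd⟩ :=
    exists_frame e f z C s t r hee hff hef hC hs0 ht0 hs ht hz
  refine ⟨c, n, m, ρ, ρ * C, F, hρ, by nlinarith, by nlinarith, hcr, ?_, by rw [hcos], ?_⟩
  · ext u
    constructor
    · rintro ⟨hur, w, ⟨σ', σ, hσ', hσ, hσσ, hw1⟩, ⟨τ1, τ2, hτ1, hτ2, hττ, hw2⟩⟩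
      have hw : σ • (z - z) + σ' • (u - z) = (τ1*X)•e + (τ2*Y)•f := by
        rw [mul_smul, mul_smul, ← hxe, ← hyf]
        have a1 : σ = 1 - σ' := by linarith
        have a2 : τ1 = 1 - τ2 := by linarith
        subst a1 a2
        linear_combination (norm := module) hw1 - hw2
      rw [sub_self, smul_zero, zero_add] at hw
      have hσ0 : σ' ≠ 0 := by
        rintro rfl
        rw [zero_smul] at hw
        have k1 := congrArg (fun v => inner ℝ v v) hw
        simp only [inner_add_left, inner_add_right, real_inner_smul_left, real_inner_smul_right,
          hee, hff, hef, hfe, inner_zero_left] at k1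
        have k2 : (τ1*X + τ2*Y*C)^2 + (τ2*Y)^2*(1-C^2) = 0 := by linear_combination -k1
        have k3 : 0 ≤ (τ2*Y)^2*(1-C^2) := mul_nonneg (sq_nonneg _) (by linarith)
        have k4 : (τ2*Y)^2*(1-C^2) = 0 := by nlinarith [sq_nonneg (τ1*X + τ2*Y*C)]
        have k5 : τ2 * Y = 0 := by
          rcases mul_eq_zero.1 k4 with h | h
          · exact pow_eq_zero_iff two_ne_zero |>.1 h
          · linarith
        have k6 : τ2 = 0 := (mul_eq_zero.1 k5).resolve_right hY.ne'
        rw [k6] at k2 hττ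
        have : τ1 = 1 := by linarith
        rw [this] at k2
        nlinarith
      have hσp : 0 < σ' := lt_of_le_of_ne hσ' (Ne.symm hσ0)
      have hu : u = z + (τ1*X/σ')•e + (τ2*Y/σ')•f := by
        have : u - z = σ'⁻¹ • ((τ1*X)•e + (τ2*Y)•f) := by rw [← hw, inv_smul_smul₀ hσ0]
        rw [eq_comm, ← sub_eq_zero]
        linear_combination (norm := module) -this
      have hq := hquad (τ1*X/σ') (τ2*Y/σ') (by rw [← hu]; exact hur)
      have hge := fwdR s t C _ _ hs0 ht0 hC1 (by positivity) (by positivity) (by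
        by_contra hcon
        push Not at hcon
        obtain ⟨c1, c2⟩ := hcon
        have d1 : τ1 = 0 := by
          by_contra hh
          exact absurd c1 (by positivity)
        have d2 : τ2 = 0 := by
          by_contra hh
          exact absurd c2 (by positivity)
        linarith) hq
      obtain ⟨a, b, hab, hah⟩ := hfwd (τ1*X/σ') (τ2*Y/σ')
      rw [← hu] at hab
      refine ⟨a, b, ?_, ?_, hab⟩
      · have := F.normsq a b
        rw [← hab, hur] at this
        linarith
      · have := mul_nonneg hk.le (sub_nonneg.2 hge)
        linarith
    · rintro ⟨a, b, hab, hah, hu⟩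
      have hur : ‖u‖ = r := by
        have := F.normsq a b
        rw [← hu] at this
        have : ‖u‖^2 = r^2 := by linarith
        exact (pow_left_inj₀ (norm_nonneg _) hr.le two_ne_zero).1 this
      obtain ⟨α, β, hαβ, hk2⟩ := hbwd a b
      rw [← hu] at hαβ
      have hq := hquad α β (by rw [← hαβ]; exact hur)
      have hge : s*t ≤ α*t+β*s := by
        by_contra hcon
        push Not at hcon
        nlinarith
      have hα := bwdR s t C α β hs0 ht0 hC1 hq hge
      have hβ := bwdR t s C β α ht0 hs0 hC1 (by linarith) (by linarith)
      refine ⟨hur, ?_⟩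
      set T := α/X + β/Y with hT
      have hT0 : 0 < T := by
        by_contra hcon
        push Not at hcon
        have d1 : 0 ≤ α/X := by positivity
        have d2 : 0 ≤ β/Y := by positivity
        have d3 : α/X = 0 := by linarith
        have d4 : β/Y = 0 := by linarith
        have d5 : α = 0 := by simpa [hX.ne'] using d3
        have d6 : β = 0 := by simpa [hY.ne'] using d4
        rw [d5, d6] at hge
        nlinarith
      have hw : (α/X/T)•x + (β/Y/T)•y ∈ segment ℝ x y :=
        ⟨_, _, by positivity, by positivity, by rw [← add_div, ← hT, div_self hT0.ne'], rfl⟩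
      obtain ⟨w, hwd⟩ : ∃ w, w = (α/X/T)•x + (β/Y/T)•y := ⟨_, rfl⟩
      rw [← hwd] at hw
      have hwn : ‖w‖ < r := by
        have := (convex_ball (0:EuclideanSpace ℝ (Fin d)) r).segment_subset
          (by simpa using hx) (by simpa using hy) hw
        simpa using this
      have huw : u - z = T • (w - z) := by
        have e1 : w - z = (α/X/T)•(x-z) + (β/Y/T)•(y-z) := by
          have : β/Y/T = 1 - α/X/T := by
            rw [eq_sub_iff_add_eq', ← add_div, ← hT, div_self hT0.ne']
          rw [hwd, this]; module
        have e2 : T * (α/X/T) * X = α := by field_simp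
        have e3 : T * (β/Y/T) * Y = β := by field_simp
        calc u - z = α•e + β•f := by rw [hαβ]; module
          _ = (T * (α/X/T) * X)•e + (T * (β/Y/T) * Y)•f := by rw [e2, e3]
          _ = T • (w - z) := by rw [e1, hxe, hyf]; module
      have hT1 : 1 ≤ T := by
        by_contra hcon
        push Not at hcon
        have e1 : u = (1-T)•z + T•w := by linear_combination (norm := module) huw
        have e2 : ‖u‖ ≤ (1-T)*‖z‖ + T*‖w‖ := by
          rw [e1]
          refine (norm_add_le _ _).trans ?_
          rw [norm_smul, norm_smul, Real.norm_of_nonneg (by linarith), Real.norm_of_nonneg hT0.le]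
        rw [hur, hz] at e2
        nlinarith
      refine ⟨w, ⟨T⁻¹, 1 - T⁻¹, by positivity, ?_, by ring, ?_⟩, hw⟩
      · rw [sub_nonneg]; exact inv_le_one_of_one_le₀ hT1
      · have : w - z = T⁻¹ • (u - z) := by rw [huw, inv_smul_smul₀ hT0.ne']
        linear_combination (norm := module) -this
  · set P := affineSpan ℝ ({x, y, z} : Set (EuclideanSpace ℝ (Fin d))) with hP
    have hxP : x ∈ P := subset_affineSpan ℝ _ (by simp)
    have hyP : y ∈ P := subset_affineSpan ℝ _ (by simp)
    have hzP : z ∈ P := subset_affineSpan ℝ _ (by simp)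
    have hcP : c ∈ P := by
      have h1 : e ∈ P.direction := hmemS _ (AffineSubspace.vsub_mem_direction hxP hzP)
      have h2 : f ∈ P.direction := hmemT _ (AffineSubspace.vsub_mem_direction hyP hzP)
      have h3 := AffineSubspace.vadd_mem_of_mem_direction
        (P.direction.add_mem (P.direction.smul_mem α0 h1) (P.direction.smul_mem β0 h2)) hzP
      rw [hc0]
      convert h3 using 1
      rw [vadd_eq_add]; module
    have hle : P ≤ AffineSubspace.mk' z (Submodule.span ℝ {e, f}) := by
      rw [hP, affineSpan_le]
      intro p hp
      simp only [mem_insert_iff, mem_singleton_iff] at hp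
      rw [SetLike.mem_coe, AffineSubspace.mem_mk', vsub_eq_sub, Submodule.mem_span_pair]
      rcases hp with rfl | rfl | rfl
      · exact ⟨X, 0, by rw [hxe]; simp⟩
      · exact ⟨0, Y, by rw [hyf]; simp⟩
      · exact ⟨0, 0, by simp⟩
    apply le_antisymm
    · have := Metric.infDist_le_dist_of_mem (x := (0:EuclideanSpace ℝ (Fin d))) (s := (P : Set _)) hcP
      simpa using this
    · rw [Metric.le_infDist ⟨c, hcP⟩]
      intro u hu
      have h1 := hle hu
      rw [AffineSubspace.mem_mk', vsub_eq_sub, Submodule.mem_span_pair] at h1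
      obtain ⟨α, β, h1⟩ := h1
      obtain ⟨a, b, hab, -⟩ := hfwd α β
      have h2 : u = c + a•n + b•m := by
        rw [← hab, add_assoc, h1]; simp
      have h3 := F.normsq a b
      rw [← h2] at h3
      rw [dist_zero_left]
      refine (sq_le_sq₀ (norm_nonneg _) (norm_nonneg _)).1 ?_
      nlinarith [sq_nonneg a, sq_nonneg b]

theorem stmt18 (d : ℕ) (hd : 2 ≤ d) (r : ℝ) (hr : 0 < r)
    (x y p q z : EuclideanSpace ℝ (Fin d))
    (hx : ‖x‖ < r) (hy : ‖y‖ < r) (hp : ‖p‖ < r) (hq : ‖q‖ < r) (hz : ‖z‖ = r)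
    (hxy : x ≠ y) (hpq : p ≠ q)
    (hxyz : ¬ Collinear ℝ ({x, y, z} : Set (EuclideanSpace ℝ (Fin d))))
    (hpqz : ¬ Collinear ℝ ({p, q, z} : Set (EuclideanSpace ℝ (Fin d))))
    (hcong : ∃ φ : EuclideanSpace ℝ (Fin d) ≃ₗᵢ[ℝ] EuclideanSpace ℝ (Fin d),
      φ '' sphProj r (segment ℝ x y) z = sphProj r (segment ℝ p q) z) :
    Metric.infDist (0 : EuclideanSpace ℝ (Fin d))
        ((affineSpan ℝ ({x, y, z} : Set (EuclideanSpace ℝ (Fin d))) : AffineSubspace ℝ _) :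
          Set (EuclideanSpace ℝ (Fin d))) =
      Metric.infDist (0 : EuclideanSpace ℝ (Fin d))
        ((affineSpan ℝ ({p, q, z} : Set (EuclideanSpace ℝ (Fin d))) : AffineSubspace ℝ _) :
          Set (EuclideanSpace ℝ (Fin d))) ∧
      ∠ x z y = ∠ p z q := by
  obtain ⟨φ, hφ⟩ := hcong
  obtain ⟨c, n, m, ρ, h, F, hρ, h1, h2, hcr, hA, hcos, hinf⟩ := exists_cap r hr x y z hx hy hz hxyz
  obtain ⟨c', n', m', ρ', h', F', hρ', h1', h2', hcr', hA', hcos', hinf'⟩ :=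
    exists_cap r hr p q z hp hq hz hpqz
  have G : IsFr (φ c) (φ n) (φ m) :=
    ⟨by rw [φ.inner_map_map, F.nn], by rw [φ.inner_map_map, F.mm], by rw [φ.inner_map_map, F.nm],
      by rw [φ.inner_map_map, F.cn], by rw [φ.inner_map_map, F.cm]⟩
  have himg : capS (φ c) (φ n) (φ m) ρ h = capS c' n' m' ρ' h' := by
    rw [← hA', ← hφ, hA]
    ext u
    constructor
    · rintro ⟨a, b, hab, ha, rfl⟩
      exact ⟨c + a•n + b•m, ⟨a, b, hab, ha, rfl⟩, by simp⟩
    · rintro ⟨_, ⟨a, b, hab, ha, rfl⟩, rfl⟩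
      exact ⟨a, b, hab, ha, by simp⟩
  obtain ⟨e1, e2, e3⟩ := cap_eq G F' hρ hρ' (by rw [φ.norm_map]; exact hcr) hcr' h1 h2 h1' h2' himg
  refine ⟨by rw [hinf, hinf', ← e1, φ.norm_map], ?_⟩
  apply Real.injOn_cos ⟨angle_nonneg _ _ _, angle_le_pi _ _ _⟩ ⟨angle_nonneg _ _ _, angle_le_pi _ _ _⟩
  rw [hcos, hcos', e2] at e3
  exact mul_left_cancel₀ hρ'.ne' e3
end
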